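/- Define h_n(X) = sup { tr[σ X] : σ positive semidefinite on A^{⊗n} ⊗ R^{⊗n}, tr_{R^n} σ = σ_A^{⊗n} } for a fixed positive semidefinite σ_A on A. Then h is submultiplicative: for positive semidefinite X on A^m ⊗ R^m and Y on A^k ⊗ R^k, h_{m+k}(X ⊗ Y) ≤ h_m(X) · h_k(Y). -/

import Mathlib

open Matrix
open scoped ComplexOrder Kronecker

noncomputable section

/-- Partial trace over the second tensor factor. -/
def ptraceR {ιA ιR : Type*} [Fintype ιR]
    (M : Matrix (ιA × ιR) (ιA × ιR) ℂ) : Matrix ιA ιA ℂ :=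
  fun i j => ∑ k : ιR, M (i, k) (j, k)

/-- `n`-fold tensor power of a matrix. -/
def tpow {ι : Type*} (σ : Matrix ι ι ℂ) (n : ℕ) :
    Matrix (Fin n → ι) (Fin n → ι) ℂ :=
  fun f g => ∏ i, σ (f i) (g i)

/-- `h_n(X) = sup { tr[σ X] : σ ≽ 0 on A^n ⊗ R^n, tr_{R^n} σ = σ_A^{⊗n} }`. -/
def hFun {ιA ιR : Type*} [Fintype ιA] [Fintype ιR]
    (σA : Matrix ιA ιA ℂ) (n : ℕ)
    (X : Matrix ((Fin n → ιA) × (Fin n → ιR)) ((Fin n → ιA) × (Fin n → ιR)) ℂ) :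
    EReal :=
  ⨆ (σ : Matrix ((Fin n → ιA) × (Fin n → ιR)) ((Fin n → ιA) × (Fin n → ιR)) ℂ)
    (_ : σ.PosSemidef ∧ ptraceR σ = tpow σA n),
    (((σ * X).trace.re : ℝ) : EReal)

/-- Reindexing `A^{m+k} × R^{m+k} ≃ (A^m × R^m) × (A^k × R^k)`. -/
def splitEquiv (ιA ιR : Type*) (m k : ℕ) :
    ((Fin (m + k) → ιA) × (Fin (m + k) → ιR)) ≃
      (((Fin m → ιA) × (Fin m → ιR)) × ((Fin k → ιA) × (Fin k → ιR))) :=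
  (Equiv.prodCongr
    (((Equiv.arrowCongr finSumFinEquiv.symm (Equiv.refl ιA)).trans
      (Equiv.sumArrowEquivProdArrow _ _ ιA)))
    (((Equiv.arrowCongr finSumFinEquiv.symm (Equiv.refl ιR)).trans
      (Equiv.sumArrowEquivProdArrow _ _ ιR)))).trans
    (Equiv.prodProdProdComm _ _ _ _)

/-- The trace of a product of two positive semidefinite matrices is nonnegative. -/
lemma trace_mul_nonneg_of_posSemidef {n : Type*} [Fintype n] {M N : Matrix n n ℂ}
    (hM : M.PosSemidef) (hN : N.PosSemidef) : 0 ≤ (M * N).trace := by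
  classical
  obtain ⟨k, v, rfl⟩ := Matrix.posSemidef_iff_eq_sum_vecMulVec.mp hM
  rw [Finset.sum_mul, Matrix.trace_sum]
  refine Finset.sum_nonneg fun i _ => ?_
  rw [Matrix.trace_mul_comm, Matrix.mul_vecMulVec, Matrix.trace_vecMulVec, dotProduct_comm]
  exact hN.dotProduct_mulVec_nonneg (v i)

/-- A tensor power of a positive semidefinite matrix is positive semidefinite. -/
lemma tpow_posSemidef {ι : Type*} [Fintype ι] {σ : Matrix ι ι ℂ} (hσ : σ.PosSemidef) (n : ℕ) :
    (tpow σ n).PosSemidef := by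
  classical
  induction n with
  | zero =>
    have : tpow σ 0 = 1 := by
      ext f g
      simp [tpow, Matrix.one_apply, Subsingleton.elim f g]
    rw [this]
    exact .one
  | succ n ih =>
    have : tpow σ (n + 1) =
        (σ ⊗ₖ tpow σ n).submatrix (fun f => (f 0, Fin.tail f)) (fun f => (f 0, Fin.tail f)) := by
      ext f g
      simp [tpow, Fin.prod_univ_succ, Fin.tail]
    rw [this]
    exact (hσ.kronecker ih).submatrix _

lemma trace_ptraceR {ιA ιR : Type*} [Fintype ιA] [Fintype ιR]
    (M : Matrix (ιA × ιR) (ιA × ιR) ℂ) : (ptraceR M).trace = M.trace := by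
  simp [Matrix.trace, ptraceR, Fintype.sum_prod_type]

lemma trace_submatrix_self {m n : Type*} [Fintype m] [Fintype n] (e : m ≃ n)
    (M : Matrix n n ℂ) : (M.submatrix e e).trace = M.trace :=
  e.sum_comp fun i => M i i

lemma ptraceR_kronecker_single {ιA ιR : Type*} [Fintype ιR] [DecidableEq ιR]
    (M : Matrix ιA ιA ℂ) (r : ιR) : ptraceR (M ⊗ₖ Matrix.single r r (1 : ℂ)) = M := by
  ext i j
  simp [ptraceR, Matrix.single_apply]

lemma posSemidef_single_self {ι : Type*} [Fintype ι] [DecidableEq ι] (r : ι) :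
    (Matrix.single r r (1 : ℂ)).PosSemidef := by
  simpa using Matrix.posSemidef_conjTranspose_mul_self (Matrix.single r r (1 : ℂ))

/-- A positive semidefinite matrix is dominated by a real multiple of the identity. -/
lemma exists_smul_one_sub_posSemidef {n : Type*} [Fintype n] [DecidableEq n] {Y : Matrix n n ℂ}
    (hY : Y.PosSemidef) : ∃ c : ℝ, ((c : ℂ) • (1 : Matrix n n ℂ) - Y).PosSemidef := by
  open scoped MatrixOrder Matrix.Norms.L2Operator in
  refine ⟨‖Y‖, ?_⟩
  have h := Matrix.le_iff.mp (IsSelfAdjoint.le_algebraMap_norm_self (a := Y) hY.1)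
  rw [Algebra.algebraMap_eq_smul_one] at h
  simpa using h

/-- The contraction `⟨x| M |x⟩` of the first tensor factor against a vector. -/
def contractVec {P U : Type*} [Fintype P] (x : P → ℂ) (M : Matrix (P × U) (P × U) ℂ) :
    Matrix U U ℂ :=
  fun u v => ∑ p, ∑ q, star (x p) * M (p, u) (q, v) * x q

lemma contractVec_posSemidef {P U : Type*} [Fintype P] [Fintype U] (x : P → ℂ)
    {M : Matrix (P × U) (P × U) ℂ} (hM : M.PosSemidef) : (contractVec x M).PosSemidef := by
  classical
  let V : Matrix (P × U) U ℂ := fun q u => if q.2 = u then x q.1 else 0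
  have hV : ∀ q u, V q u = if q.2 = u then x q.1 else 0 := fun _ _ => rfl
  have : contractVec x M = Vᴴ * M * V := by
    ext u v
    simp only [contractVec, hV, Matrix.mul_apply, Matrix.conjTranspose_apply,
      Fintype.sum_prod_type, apply_ite star, star_zero, ite_mul, zero_mul, mul_ite, mul_zero,
      Finset.sum_ite_eq', Finset.mem_univ, if_true, Finset.sum_mul]
    exact Finset.sum_comm
  rw [this]
  exact hM.conjTranspose_mul_mul_same V

/-- The partial trace over the second tensor factor of `M * (1 ⊗ Y)`. -/
def contractSnd {P U : Type*} [Fintype U] (Y : Matrix U U ℂ) (M : Matrix (P × U) (P × U) ℂ) :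
    Matrix P P ℂ :=
  fun p q => ∑ u, ∑ v, M (p, u) (q, v) * Y v u

lemma trace_contractSnd_mul {P U : Type*} [Fintype P] [Fintype U] (X : Matrix P P ℂ)
    (Y : Matrix U U ℂ) (M : Matrix (P × U) (P × U) ℂ) :
    (contractSnd Y M * X).trace = (M * (X ⊗ₖ Y)).trace := by
  simp only [Matrix.trace, Matrix.diag, Matrix.mul_apply, contractSnd, Fintype.sum_prod_type,
    Matrix.kroneckerMap_apply, Finset.sum_mul]
  refine Finset.sum_congr rfl fun p _ => ?_
  rw [Finset.sum_comm]
  refine Finset.sum_congr rfl fun u _ => Finset.sum_congr rfl fun q _ =>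
    Finset.sum_congr rfl fun v _ => by ring

lemma dotProduct_contractSnd_mulVec {P U : Type*} [Fintype P] [Fintype U] (Y : Matrix U U ℂ)
    (M : Matrix (P × U) (P × U) ℂ) (x : P → ℂ) :
    star x ⬝ᵥ (contractSnd Y M *ᵥ x) = (contractVec x M * Y).trace := by
  have h : star x ⬝ᵥ (contractSnd Y M *ᵥ x) =
      (contractSnd Y M * Matrix.vecMulVec x (star x)).trace := by
    rw [Matrix.mul_vecMulVec, Matrix.trace_vecMulVec, dotProduct_comm]
  rw [h, trace_contractSnd_mul]
  simp only [Matrix.trace, Matrix.diag, Matrix.mul_apply, contractVec, Fintype.sum_prod_type,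
    Matrix.kroneckerMap_apply, Finset.sum_mul, Matrix.vecMulVec_apply, Pi.star_apply]
  rw [Finset.sum_comm]
  refine Finset.sum_congr rfl fun u _ => ?_
  rw [Finset.sum_comm (γ := U)]
  refine Finset.sum_congr rfl fun p _ => ?_
  rw [Finset.sum_comm]
  exact Finset.sum_congr rfl fun v _ => Finset.sum_congr rfl fun q _ => by ring

lemma contractSnd_posSemidef {P U : Type*} [Fintype P] [Fintype U] {Y : Matrix U U ℂ}
    (hY : Y.PosSemidef) {M : Matrix (P × U) (P × U) ℂ} (hM : M.PosSemidef) :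
    (contractSnd Y M).PosSemidef := by
  refine .of_dotProduct_mulVec_nonneg ?_ fun x => ?_
  · ext p q
    simp only [Matrix.conjTranspose_apply, contractSnd, star_sum, star_mul']
    rw [Finset.sum_comm]
    refine Finset.sum_congr rfl fun u _ => Finset.sum_congr rfl fun v _ => ?_
    rw [hM.1.apply, hY.1.apply]
  · rw [dotProduct_contractSnd_mulVec]
    exact trace_mul_nonneg_of_posSemidef (contractVec_posSemidef x hM) hY

/-- A bound on `tr[ω Y]` over `ω` with marginal `S` scales to `ω` with marginal `t • S`. -/
lemma re_trace_mul_le_of_ptraceR_eq_smul {ιA ιR : Type*} [Fintype ιA] [Fintype ιR]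
    {S : Matrix ιA ιA ℂ} {Y : Matrix (ιA × ιR) (ιA × ιR) ℂ} {c : ℝ}
    (hc : ∀ ω : Matrix (ιA × ιR) (ιA × ιR) ℂ, ω.PosSemidef → ptraceR ω = S →
      (ω * Y).trace.re ≤ c)
    {t : ℝ} (ht : 0 ≤ t) {ω : Matrix (ιA × ιR) (ιA × ιR) ℂ} (hω : ω.PosSemidef)
    (hS : ptraceR ω = (t : ℂ) • S) : (ω * Y).trace.re ≤ t * c := by
  rcases ht.eq_or_lt with rfl | ht
  · have : ω = 0 := by
      rw [← hω.trace_eq_zero_iff, ← trace_ptraceR, hS]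
      simp
    simp [this]
  · have hpos : (0 : ℂ) ≤ ((t⁻¹ : ℝ) : ℂ) := by
      exact_mod_cast (inv_pos.mpr ht).le
    have htc : (t : ℂ) ≠ 0 := by exact_mod_cast ht.ne'
    have h := hc (((t⁻¹ : ℝ) : ℂ) • ω) (hω.smul hpos) (by
      have : ptraceR (((t⁻¹ : ℝ) : ℂ) • ω) = ((t⁻¹ : ℝ) : ℂ) • ptraceR ω := by
        ext i j
        simp [ptraceR, Finset.mul_sum]
      rw [this, hS, smul_smul]
      simp [htc])
    rw [Matrix.smul_mul, Matrix.trace_smul, smul_eq_mul, Complex.re_ofReal_mul] at h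
    rwa [inv_mul_le_iff₀ ht] at h

/-- The bound of `re_trace_mul_le_of_ptraceR_eq_smul` also holds for marginals below `t • S`. -/
lemma re_trace_mul_le_of_smul_sub_ptraceR_posSemidef {ιA ιR : Type*} [Fintype ιA] [Fintype ιR]
    [Nonempty ιR] {S : Matrix ιA ιA ℂ} {X : Matrix (ιA × ιR) (ιA × ιR) ℂ} (hX : X.PosSemidef)
    {c : ℝ}
    (hc : ∀ ω : Matrix (ιA × ιR) (ιA × ιR) ℂ, ω.PosSemidef → ptraceR ω = S →
      (ω * X).trace.re ≤ c)
    {t : ℝ} (ht : 0 ≤ t) {τ : Matrix (ιA × ιR) (ιA × ιR) ℂ} (hτ : τ.PosSemidef)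
    (hS : ((t : ℂ) • S - ptraceR τ).PosSemidef) : (τ * X).trace.re ≤ t * c := by
  classical
  obtain ⟨r⟩ := ‹Nonempty ιR›
  set δ := ((t : ℂ) • S - ptraceR τ) ⊗ₖ Matrix.single r r (1 : ℂ) with hδ
  have hδp : δ.PosSemidef := hS.kronecker (posSemidef_single_self r)
  have hadd : ptraceR (τ + δ) = ptraceR τ + ptraceR δ := by
    ext i j
    simp [ptraceR, Finset.sum_add_distrib]
  have h := re_trace_mul_le_of_ptraceR_eq_smul hc ht (hτ.add hδp) (by
    rw [hadd, hδ, ptraceR_kronecker_single, add_sub_cancel])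
  rw [Matrix.add_mul, Matrix.trace_add, Complex.add_re] at h
  have := (Complex.le_def.mp (trace_mul_nonneg_of_posSemidef hδp hX)).1
  simp only [Complex.zero_re] at this
  linarith

/-- Contracting a state with product marginal `S ⊗ T` against `Y` leaves a marginal at most
`c • S`, where `c` bounds `tr[ω Y]` over states `ω` with marginal `T`. -/
lemma smul_sub_ptraceR_contractSnd_posSemidef {A R B Q : Type*} [Fintype A] [Fintype R]
    [Fintype B] [Fintype Q] {S : Matrix A A ℂ} (hS : S.PosSemidef) {T : Matrix B B ℂ}
    {Y : Matrix (B × Q) (B × Q) ℂ} (hY : Y.PosSemidef) {c : ℝ}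
    (hc : ∀ ω : Matrix (B × Q) (B × Q) ℂ, ω.PosSemidef → ptraceR ω = T →
      (ω * Y).trace.re ≤ c)
    {M : Matrix ((A × R) × (B × Q)) ((A × R) × (B × Q)) ℂ} (hM : M.PosSemidef)
    (hmarg : ∀ a a' b b', ∑ r, ∑ q, M ((a, r), (b, q)) ((a', r), (b', q)) = S a a' * T b b') :
    ((c : ℂ) • S - ptraceR (contractSnd Y M)).PosSemidef := by
  classical
  have hτ := contractSnd_posSemidef hY hM
  have hreal : IsSelfAdjoint (c : ℂ) := Complex.conj_ofReal c
  have hherm : (ptraceR (contractSnd Y M)).IsHermitian := by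
    ext a b
    simp only [Matrix.conjTranspose_apply, ptraceR, star_sum]
    exact Finset.sum_congr rfl fun r _ => hτ.1.apply _ _
  refine .of_dotProduct_mulVec_nonneg ((hS.1.smul hreal).sub hherm) fun v => ?_
  let x : R → A × R → ℂ := fun r p => if p.2 = r then v p.1 else 0
  set ω := ∑ r, contractVec (x r) M with hω
  have hωp : ω.PosSemidef := Matrix.posSemidef_sum _ fun r _ => contractVec_posSemidef (x r) hM
  have hquad : star v ⬝ᵥ (ptraceR (contractSnd Y M) *ᵥ v) = (ω * Y).trace := by
    rw [hω, Finset.sum_mul, Matrix.trace_sum]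
    simp only [← dotProduct_contractSnd_mulVec]
    simp only [dotProduct, Matrix.mulVec, ptraceR, x, Fintype.sum_prod_type, Pi.star_apply,
      apply_ite star, star_zero, ite_mul, zero_mul, mul_ite, mul_zero,
      Finset.sum_ite_eq', Finset.mem_univ, if_true, Finset.mul_sum,
      Finset.sum_mul, Finset.sum_ite_irrel, Finset.sum_const_zero]
    rw [Finset.sum_comm (γ := R)]
    exact Finset.sum_congr rfl fun a _ => Finset.sum_comm
  obtain ⟨hsre, hsim⟩ := Complex.le_def.mp (hS.dotProduct_mulVec_nonneg v)
  set s := star v ⬝ᵥ (S *ᵥ v) with hs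
  have hsr : s = (s.re : ℂ) := by
    apply Complex.ext
    · simp
    · simpa using hsim.symm
  have hωT : ptraceR ω = (s.re : ℂ) • T := by
    rw [← hsr]
    ext b b'
    simp only [hs, dotProduct, Matrix.mulVec, Matrix.smul_apply, smul_eq_mul, Pi.star_apply,
      Finset.mul_sum, Finset.sum_mul]
    simp only [hω, ptraceR, Matrix.sum_apply, contractVec, x, Fintype.sum_prod_type,
      apply_ite star, star_zero, ite_mul, zero_mul, mul_ite, mul_zero,
      Finset.sum_ite_eq', Finset.mem_univ, if_true, Finset.sum_ite_irrel,
      Finset.sum_const_zero]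
    rw [Finset.sum_comm]
    refine (Finset.sum_congr rfl fun r _ => Finset.sum_comm_cycle.symm).trans ?_
    rw [← Finset.sum_comm_cycle]
    refine Finset.sum_congr rfl fun a _ => Finset.sum_congr rfl fun a' _ => ?_
    rw [show star (v a) * (S a a' * v a') * T b b' = star (v a) * (S a a' * T b b') * v a' by ring,
      ← hmarg]
    simp only [Finset.mul_sum, Finset.sum_mul]
  have hle := re_trace_mul_le_of_ptraceR_eq_smul hc (by simpa using hsre) hωp hωT
  have htr := Complex.le_def.mp (trace_mul_nonneg_of_posSemidef hωp hY)
  rw [Matrix.sub_mulVec, dotProduct_sub, Matrix.smul_mulVec, dotProduct_smul, hquad, ← hs,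
    smul_eq_mul, hsr, Complex.le_def]
  constructor
  · simp
    linarith
  · simpa using htr.2.symm

lemma exists_hFun_eq_coe {ιA ιR : Type*} [Fintype ιA] [Fintype ιR] [Nonempty ιR]
    {σA : Matrix ιA ιA ℂ} (hσA : σA.PosSemidef) (n : ℕ)
    {X : Matrix ((Fin n → ιA) × (Fin n → ιR)) ((Fin n → ιA) × (Fin n → ιR)) ℂ}
    (hX : X.PosSemidef) :
    ∃ c : ℝ, 0 ≤ c ∧ hFun σA n X = c ∧
      ∀ ω : Matrix ((Fin n → ιA) × (Fin n → ιR)) ((Fin n → ιA) × (Fin n → ιR)) ℂ,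
        ω.PosSemidef → ptraceR ω = tpow σA n → (ω * X).trace.re ≤ c := by
  classical
  have hub : ∀ ω : Matrix ((Fin n → ιA) × (Fin n → ιR)) ((Fin n → ιA) × (Fin n → ιR)) ℂ,
      ω.PosSemidef → ptraceR ω = tpow σA n → (((ω * X).trace.re : ℝ) : EReal) ≤ hFun σA n X :=
    fun ω h₁ h₂ => le_iSup₂ (f := fun (σ : Matrix ((Fin n → ιA) × (Fin n → ιR))
      ((Fin n → ιA) × (Fin n → ιR)) ℂ) (_ : σ.PosSemidef ∧ ptraceR σ = tpow σA n) =>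
        (((σ * X).trace.re : ℝ) : EReal)) ω ⟨h₁, h₂⟩
  have hnonneg : 0 ≤ hFun σA n X := by
    obtain ⟨r⟩ := (inferInstance : Nonempty (Fin n → ιR))
    have hp := (tpow_posSemidef hσA n).kronecker (posSemidef_single_self r)
    refine le_trans ?_ (hub _ hp (ptraceR_kronecker_single _ _))
    exact_mod_cast (Complex.le_def.mp (trace_mul_nonneg_of_posSemidef hp hX)).1
  obtain ⟨C, hC⟩ := exists_smul_one_sub_posSemidef hX
  have hbdd : hFun σA n X ≤ ((C * (tpow σA n).trace.re : ℝ) : EReal) := by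
    refine iSup₂_le fun ω hω => EReal.coe_le_coe_iff.mpr ?_
    have h := (Complex.le_def.mp (trace_mul_nonneg_of_posSemidef hω.1 hC)).1
    rw [Matrix.mul_sub, Matrix.trace_sub, Matrix.mul_smul, Matrix.mul_one, Matrix.trace_smul,
      ← trace_ptraceR ω, hω.2, smul_eq_mul, Complex.sub_re, Complex.re_ofReal_mul] at h
    simp only [Complex.zero_re] at h
    linarith
  have hcoe : ((hFun σA n X).toReal : EReal) = hFun σA n X :=
    EReal.coe_toReal (ne_top_of_le_ne_top (EReal.coe_ne_top _) hbdd)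
      (ne_bot_of_le_ne_bot EReal.zero_ne_bot hnonneg)
  refine ⟨(hFun σA n X).toReal, EReal.toReal_nonneg hnonneg, hcoe.symm, fun ω h₁ h₂ => ?_⟩
  rw [← EReal.coe_le_coe_iff, hcoe]
  exact hub ω h₁ h₂

lemma splitEquiv_symm_apply {ιA ιR : Type*} {m k : ℕ} (a : Fin m → ιA) (r : Fin m → ιR)
    (b : Fin k → ιA) (q : Fin k → ιR) :
    (splitEquiv ιA ιR m k).symm ((a, r), (b, q)) = (Fin.append a b, Fin.append r q) := by
  rw [Equiv.symm_apply_eq]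
  simp [splitEquiv, Equiv.sumArrowEquivProdArrow, Equiv.arrowCongr, funext_iff]

lemma sum_sum_append {ι : Type*} [Fintype ι] {m k : ℕ} (f : (Fin (m + k) → ι) → ℂ) :
    ∑ r : Fin m → ι, ∑ q : Fin k → ι, f (Fin.append r q) = ∑ s, f s := by
  rw [← Fintype.sum_prod_type' (fun r q => f (Fin.append r q))]
  exact (Fin.appendEquiv m k).sum_comp f

/-- Submultiplicativity of the support function:
`h_{m+k}(X ⊗ Y) ≤ h_m(X) h_k(Y)` for positive semidefinite `X, Y`. -/
theorem hFun_submultiplicative {ιA ιR : Type*} [Fintype ιA] [DecidableEq ιA]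
    [Fintype ιR] [DecidableEq ιR] [Nonempty ιR]
    (σA : Matrix ιA ιA ℂ) (hσA : σA.PosSemidef) (m k : ℕ)
    (X : Matrix ((Fin m → ιA) × (Fin m → ιR)) ((Fin m → ιA) × (Fin m → ιR)) ℂ)
    (Y : Matrix ((Fin k → ιA) × (Fin k → ιR)) ((Fin k → ιA) × (Fin k → ιR)) ℂ)
    (hX : X.PosSemidef) (hY : Y.PosSemidef) :
    hFun σA (m + k)
      ((X ⊗ₖ Y).submatrix (splitEquiv ιA ιR m k) (splitEquiv ιA ιR m k)) ≤
    hFun σA m X * hFun σA k Y := by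
  obtain ⟨a, ha, haX, hXa⟩ := exists_hFun_eq_coe hσA m hX
  obtain ⟨b, hb, hbY, hYb⟩ := exists_hFun_eq_coe hσA k hY
  rw [haX, hbY, ← EReal.coe_mul]
  refine iSup₂_le fun σ hσ => EReal.coe_le_coe_iff.mpr ?_
  set e := splitEquiv ιA ιR m k with he
  set M := σ.submatrix e.symm e.symm with hM
  have hMp : M.PosSemidef := hσ.1.submatrix _
  have hmarg : ∀ a a' b b', ∑ r, ∑ q, M ((a, r), (b, q)) ((a', r), (b', q)) =
      tpow σA m a a' * tpow σA k b b' := by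
    intro a a' b b'
    simp only [hM, he, Matrix.submatrix_apply, splitEquiv_symm_apply]
    rw [sum_sum_append (fun s => σ (Fin.append a b, s) (Fin.append a' b', s))]
    have h := congrFun (congrFun hσ.2 (Fin.append a b)) (Fin.append a' b')
    rw [ptraceR] at h
    rw [h]
    simp [tpow, Fin.prod_univ_add]
  have hσM : σ = M.submatrix e e := by simp [hM]
  rw [hσM, Matrix.submatrix_mul_equiv, trace_submatrix_self, ← trace_contractSnd_mul,
    mul_comm a b]
  exact re_trace_mul_le_of_smul_sub_ptraceR_posSemidef hX hXa hb (contractSnd_posSemidef hY hMp)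
    (smul_sub_ptraceR_contractSnd_posSemidef (tpow_posSemidef hσA m) hY hYb hMp hmarg)

end
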